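/- Let d ≥ 1, t ∈ ℕ, and let u_1, …, u_L be unit vectors in ℝ^d. Then the following are equivalent: (a) for every k ∈ {0, 1, …, t} and every homogeneous polynomial p of total degree 2k in d real variables, (1/L)·∑_{ℓ=1}^L p(u_ℓ) = ∫_{S^{d-1}} p(u) dσ(u); (b) for every k ∈ {1, …, t} and every x ∈ ℝ^d, (1/L)·∑_{ℓ=1}^L ⟨x, u_ℓ⟩^{2k} = c_{d,k}·‖x‖^{2k}. -/

import Mathlib

open MeasureTheory RealInnerProductSpace

/-- `c_{d,k} = (1·3·5⋯(2k−1)) / (d·(d+2)⋯(d+2(k−1)))`. -/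
noncomputable def designConst (d k : ℕ) : ℝ :=
  (∏ i ∈ Finset.range k, (2 * (i : ℝ) + 1)) / ∏ i ∈ Finset.range k, ((d : ℝ) + 2 * i)
/-- A linear functional vanishing on all `n`-th powers of linear forms vanishes on all homogeneous
polynomials of degree `n`. -/
theorem MvPolynomial.linearMap_eq_zero_of_linearForm_pow {ι : Type*} [Fintype ι] [DecidableEq ι]
    (T : MvPolynomial ι ℝ →ₗ[ℝ] ℝ) (n : ℕ)
    (hT : ∀ x : ι → ℝ, T ((∑ i, C (x i) * X i) ^ n) = 0)
    {p : MvPolynomial ι ℝ} (hp : p.IsHomogeneous n) : T p = 0 := by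
  let P : MvPolynomial ι ℝ := ∑ a ∈ Finset.univ.piAntidiag n,
    monomial (Finsupp.equivFunOnFinite.symm a)
      ((Nat.multinomial Finset.univ a : ℝ) * T (monomial (Finsupp.equivFunOnFinite.symm a) 1))
  have hP : P = 0 := by
    refine MvPolynomial.funext fun x => ?_
    rw [map_zero, ← hT x, Finset.sum_pow_eq_sum_piAntidiag, map_sum, map_sum]
    refine Finset.sum_congr rfl fun a _ => ?_
    have h : (Nat.multinomial Finset.univ a : MvPolynomial ι ℝ) * ∏ i, (C (x i) * X i) ^ a i
        = ((Nat.multinomial Finset.univ a : ℝ) * ∏ i, x i ^ a i) •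
          monomial (Finsupp.equivFunOnFinite.symm a) 1 := by
      rw [smul_eq_C_mul, monomial_eq, Finsupp.prod_fintype _ _ (by simp)]
      simp [mul_pow, Finset.prod_mul_distrib, mul_assoc]
    rw [h, map_smul, eval_monomial, Finsupp.prod_fintype _ _ (by simp), smul_eq_mul]
    simp only [Finsupp.equivFunOnFinite_symm_apply_apply]
    ring
  have hmon : ∀ m : ι →₀ ℕ, m.degree = n → T (monomial m 1) = 0 := by
    intro m hm
    have hc : coeff m P = (Nat.multinomial Finset.univ m : ℝ) * T (monomial m 1) := by
      simp only [P, coeff_sum, coeff_monomial]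
      rw [Finset.sum_eq_single (m : ι → ℕ)]
      · simp
      · intro b _ hb
        refine if_neg fun h => hb ?_
        rw [← h]; rfl
      · intro h
        exact absurd (by simp [← hm, Finsupp.degree_eq_sum]) h
    rw [hP, coeff_zero] at hc
    exact (mul_eq_zero.mp hc.symm).resolve_left
      (Nat.cast_ne_zero.mpr (Nat.multinomial_pos _ _).ne')
  rw [p.as_sum, map_sum]
  refine Finset.sum_eq_zero fun m hm => ?_
  rw [← mul_one (coeff m p), ← smul_eq_mul, ← smul_monomial, map_smul,
    hmon m (by
      rw [Finsupp.degree_eq_weight_one]; exact hp (mem_support_iff.mp hm)), smul_zero]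

section SphereMoments

variable {d : ℕ} {σ : Measure (Metric.sphere (0 : EuclideanSpace ℝ (Fin d)) 1)}

theorem integrable_of_continuous_sphere [IsFiniteMeasure σ]
    {f : Metric.sphere (0 : EuclideanSpace ℝ (Fin d)) 1 → ℝ} (hf : Continuous f) :
    Integrable f σ :=
  hf.integrable_of_hasCompactSupport (HasCompactSupport.of_compactSpace f)

/-- The zonal moments of a measure on the sphere whose zonal moments depend only on the norm. -/
theorem integral_inner_pow_eq_of_norm_eq
    (hrot : ∀ (n : ℕ) (x y : EuclideanSpace ℝ (Fin d)), ‖x‖ = ‖y‖ →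
      ∫ v, ⟪x, (v : EuclideanSpace ℝ (Fin d))⟫ ^ n ∂σ
        = ∫ v, ⟪y, (v : EuclideanSpace ℝ (Fin d))⟫ ^ n ∂σ)
    (k : ℕ) (i : Fin d) (x : EuclideanSpace ℝ (Fin d)) :
    ∫ v, ⟪x, (v : EuclideanSpace ℝ (Fin d))⟫ ^ (2 * k) ∂σ
      = (∫ v, (v : EuclideanSpace ℝ (Fin d)) i ^ (2 * k) ∂σ) * ‖x‖ ^ (2 * k) := by
  rw [hrot (2 * k) x (‖x‖ • EuclideanSpace.single i 1) (by simp [norm_smul]),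
    ← integral_mul_const]
  refine integral_congr_ae (.of_forall fun v => ?_)
  simp only [inner_smul_left, EuclideanSpace.inner_single_left, mul_pow]
  simp [mul_comm]

/-- Comparing the coefficients of `s ^ 2` in `∫ (v i + s v j) ^ (2k + 2) = a (1 + s²) ^ (k + 1)`. -/
theorem integral_coord_pow_mul_sq [IsFiniteMeasure σ]
    (hrot : ∀ (n : ℕ) (x y : EuclideanSpace ℝ (Fin d)), ‖x‖ = ‖y‖ →
      ∫ v, ⟪x, (v : EuclideanSpace ℝ (Fin d))⟫ ^ n ∂σ
        = ∫ v, ⟪y, (v : EuclideanSpace ℝ (Fin d))⟫ ^ n ∂σ)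
    (k : ℕ) {i j : Fin d} (hij : j ≠ i) :
    (2 * (k : ℝ) + 1) * ∫ v, (v : EuclideanSpace ℝ (Fin d)) j ^ 2
        * (v : EuclideanSpace ℝ (Fin d)) i ^ (2 * k) ∂σ
      = ∫ v, (v : EuclideanSpace ℝ (Fin d)) i ^ (2 * (k + 1)) ∂σ := by
  set a := ∫ v, (v : EuclideanSpace ℝ (Fin d)) i ^ (2 * (k + 1)) ∂σ with ha
  let b : ℕ → ℝ := fun m => ∫ v, (v : EuclideanSpace ℝ (Fin d)) j ^ m
        * (v : EuclideanSpace ℝ (Fin d)) i ^ (2 * (k + 1) - m) ∂σ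
  have hpoly : (∑ m ∈ Finset.range (2 * (k + 1) + 1),
      Polynomial.monomial m (((2 * (k + 1)).choose m : ℝ) * b m) : Polynomial ℝ)
      = Polynomial.C a * Polynomial.expand ℝ 2 ((1 + Polynomial.X) ^ (k + 1)) := by
    refine Polynomial.funext fun s => ?_
    have h := integral_inner_pow_eq_of_norm_eq hrot (k + 1) i
      (EuclideanSpace.single i 1 + s • EuclideanSpace.single j 1)
    have hn : ‖EuclideanSpace.single i (1 : ℝ) + s • EuclideanSpace.single j (1 : ℝ)‖ ^ 2
        = 1 + s ^ 2 := by
      have ho : ⟪EuclideanSpace.single i (1 : ℝ), s • EuclideanSpace.single j (1 : ℝ)⟫ = 0 := by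
        rw [inner_smul_right, EuclideanSpace.inner_single_left]
        simp [hij.symm]
      rw [norm_add_sq_real, ho, norm_smul]
      simp
    rw [pow_mul ‖_‖, hn] at h
    rw [Polynomial.eval_finsetSum, Polynomial.eval_mul, Polynomial.eval_C,
      Polynomial.expand_eval, Polynomial.eval_pow, Polynomial.eval_add, Polynomial.eval_one,
      Polynomial.eval_X, ha, ← h]
    calc _ = ∑ m ∈ Finset.range (2 * (k + 1) + 1), ∫ v, ((2 * (k + 1)).choose m : ℝ) * s ^ m *
          ((v : EuclideanSpace ℝ (Fin d)) j ^ m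
            * (v : EuclideanSpace ℝ (Fin d)) i ^ (2 * (k + 1) - m)) ∂σ := by
          refine Finset.sum_congr rfl fun m _ => ?_
          rw [integral_const_mul, Polynomial.eval_monomial]
          simp only [b]; ring
      _ = _ := by
          rw [← integral_finsetSum _ fun m _ =>
            integrable_of_continuous_sphere (by fun_prop)]
          refine integral_congr_ae (.of_forall fun v => ?_)
          simp only [inner_add_left, inner_smul_left, EuclideanSpace.inner_single_left]
          conv_rhs => rw [add_comm, add_pow]
          refine Finset.sum_congr rfl fun m _ => ?_
          simp [mul_pow]; ring
  have hc := congrArg (fun p => p.coeff (2 * 1)) hpoly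
  simp only [Polynomial.finsetSum_coeff, Polynomial.coeff_monomial] at hc
  rw [Polynomial.coeff_C_mul, Polynomial.coeff_expand_mul' two_pos,
    Polynomial.coeff_one_add_X_pow, Finset.sum_ite_eq', if_pos (by simp), mul_one,
    Nat.cast_choose_two, Nat.choose_one_right] at hc
  have hb : b 2 = ∫ v, (v : EuclideanSpace ℝ (Fin d)) j ^ 2
        * (v : EuclideanSpace ℝ (Fin d)) i ^ (2 * k) ∂σ := by
    simp only [b, show 2 * (k + 1) - 2 = 2 * k by omega]
  rw [hb] at hc
  push_cast at hc
  have hk : (k : ℝ) + 1 ≠ 0 := by positivity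
  apply mul_left_cancel₀ hk
  linear_combination hc

/-- The even coordinate moments of a probability measure on the sphere whose zonal moments depend
only on the norm. -/
theorem integral_coord_pow_eq_designConst [IsProbabilityMeasure σ]
    (hrot : ∀ (n : ℕ) (x y : EuclideanSpace ℝ (Fin d)), ‖x‖ = ‖y‖ →
      ∫ v, ⟪x, (v : EuclideanSpace ℝ (Fin d))⟫ ^ n ∂σ
        = ∫ v, ⟪y, (v : EuclideanSpace ℝ (Fin d))⟫ ^ n ∂σ)
    (k : ℕ) (i : Fin d) :
    ∫ v, (v : EuclideanSpace ℝ (Fin d)) i ^ (2 * k) ∂σ = designConst d k := by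
  induction k with
  | zero => simp [designConst]
  | succ k ih =>
    have hd : 0 < d := i.pos
    have hsum : ∑ j, ∫ v, (v : EuclideanSpace ℝ (Fin d)) j ^ 2
        * (v : EuclideanSpace ℝ (Fin d)) i ^ (2 * k) ∂σ = designConst d k := by
      rw [← ih, ← integral_finsetSum _ fun m _ => integrable_of_continuous_sphere (by fun_prop)]
      refine integral_congr_ae (.of_forall fun v => ?_)
      have hv : ∑ j, (v : EuclideanSpace ℝ (Fin d)) j ^ 2 = 1 := by
        rw [← EuclideanSpace.real_norm_sq_eq, norm_eq_of_mem_sphere, one_pow]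
      simp only [← Finset.sum_mul, hv, one_mul]
    rw [← Finset.add_sum_erase _ _ (Finset.mem_univ i)] at hsum
    have hs := congrArg ((2 * (k : ℝ) + 1) * ·) hsum
    simp only [mul_add, Finset.mul_sum] at hs
    rw [Finset.sum_congr rfl fun j hj =>
      integral_coord_pow_mul_sq hrot k (Finset.ne_of_mem_erase hj), Finset.sum_const,
      Finset.card_erase_of_mem (Finset.mem_univ i), Finset.card_univ, Fintype.card_fin,
      nsmul_eq_mul, Nat.cast_pred hd] at hs
    simp only [← pow_add, show 2 + 2 * k = 2 * (k + 1) by ring] at hs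
    have hden : (d : ℝ) + 2 * k ≠ 0 := by positivity
    have hstep : designConst d (k + 1) = (2 * k + 1) * designConst d k / (d + 2 * k) := by
      rw [designConst, designConst, Finset.prod_range_succ, Finset.prod_range_succ,
        mul_div_mul_comm]
      ring
    rw [hstep, eq_div_iff hden]
    linear_combination hs

end SphereMoments

/-- For unit vectors `u_1, …, u_L` in `ℝ^d` and the uniform
(i.e. rotation-invariant) probability measure `σ` on the unit sphere `S^{d-1}`,
the cubature condition (a) for homogeneous polynomials of degree `2k`, `0 ≤ k ≤ t`,
is equivalent to the moment condition (b). -/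
theorem stmt_0 (d t L : ℕ) (hd : 1 ≤ d) (hL : 1 ≤ L)
    (u : Fin L → EuclideanSpace ℝ (Fin d)) (hu : ∀ ℓ, ‖u ℓ‖ = 1)
    (σ : Measure (Metric.sphere (0 : EuclideanSpace ℝ (Fin d)) 1))
    [IsProbabilityMeasure σ]
    (hσ : ∀ Q : EuclideanSpace ℝ (Fin d) ≃ₗᵢ[ℝ] EuclideanSpace ℝ (Fin d),
      MeasurePreserving
        (fun v : Metric.sphere (0 : EuclideanSpace ℝ (Fin d)) 1 =>
          (⟨Q v, by
              rw [mem_sphere_zero_iff_norm, Q.norm_map,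
                ← mem_sphere_zero_iff_norm]
              exact v.2⟩ :
            Metric.sphere (0 : EuclideanSpace ℝ (Fin d)) 1)) σ σ) :
    (∀ k ≤ t, ∀ p ∈ MvPolynomial.homogeneousSubmodule (Fin d) ℝ (2 * k),
        (1 / (L : ℝ)) * ∑ ℓ, MvPolynomial.eval (fun i => u ℓ i) p
          = ∫ v, MvPolynomial.eval (fun i => (v : EuclideanSpace ℝ (Fin d)) i) p ∂σ)
    ↔ (∀ k, 1 ≤ k → k ≤ t → ∀ x : EuclideanSpace ℝ (Fin d),
        (1 / (L : ℝ)) * ∑ ℓ, ⟪x, u ℓ⟫ ^ (2 * k) = designConst d k * ‖x‖ ^ (2 * k)) := by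
  have hrot : ∀ (n : ℕ) (x y : EuclideanSpace ℝ (Fin d)), ‖x‖ = ‖y‖ →
      ∫ v, ⟪x, (v : EuclideanSpace ℝ (Fin d))⟫ ^ n ∂σ
        = ∫ v, ⟪y, (v : EuclideanSpace ℝ (Fin d))⟫ ^ n ∂σ := by
    intro n x y hxy
    let Q := (ℝ ∙ (x - y))ᗮ.reflection
    have hQ : Q x = y := Submodule.reflection_sub hxy
    have hmp := hσ Q
    rw [← hQ]
    conv_rhs => rw [← hmp.map_eq]
    rw [integral_map hmp.measurable.aemeasurable
      (Continuous.aestronglyMeasurable (by fun_prop))]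
    simp only [LinearIsometryEquiv.inner_map_map]
  have hmom : ∀ (k : ℕ) (x : EuclideanSpace ℝ (Fin d)),
      ∫ v, ⟪x, (v : EuclideanSpace ℝ (Fin d))⟫ ^ (2 * k) ∂σ
        = designConst d k * ‖x‖ ^ (2 * k) := fun k x => by
    rw [integral_inner_pow_eq_of_norm_eq hrot k ⟨0, hd⟩,
      integral_coord_pow_eq_designConst hrot]
  have hform : ∀ (x v : EuclideanSpace ℝ (Fin d)) (n : ℕ),
      MvPolynomial.eval (fun i => v i)
        ((∑ i, MvPolynomial.C (x i) * MvPolynomial.X i) ^ n) = ⟪x, v⟫ ^ n := by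
    intro x v n
    simp [PiLp.inner_apply, mul_comm]
  constructor
  · intro h k _ hk x
    have := h k hk ((∑ i, MvPolynomial.C (x i) * MvPolynomial.X i) ^ (2 * k)) <| by
      have hhom := (MvPolynomial.IsHomogeneous.sum Finset.univ
        (fun i => MvPolynomial.C (x i) * MvPolynomial.X i) 1
        fun i _ => MvPolynomial.isHomogeneous_C_mul_X (x i) i).pow (2 * k)
      rwa [one_mul] at hhom
    simpa only [hform, hmom] using this
  · intro h k hk p hp
    have hint : ∀ p : MvPolynomial (Fin d) ℝ, Integrable (fun v : Metric.sphere
        (0 : EuclideanSpace ℝ (Fin d)) 1 =>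
          MvPolynomial.eval (fun i => (v : EuclideanSpace ℝ (Fin d)) i) p) σ := fun p =>
      integrable_of_continuous_sphere
        ((MvPolynomial.continuous_eval p).comp (by fun_prop))
    let T : MvPolynomial (Fin d) ℝ →ₗ[ℝ] ℝ :=
      { toFun := fun p => (1 / (L : ℝ)) * ∑ ℓ, MvPolynomial.eval (fun i => u ℓ i) p
          - ∫ v, MvPolynomial.eval (fun i => (v : EuclideanSpace ℝ (Fin d)) i) p ∂σ
        map_add' := fun p q => by
          simp only [map_add, Finset.sum_add_distrib, integral_add (hint p) (hint q)]
          ring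
        map_smul' := fun c p => by
          simp only [MvPolynomial.smul_eval, ← Finset.mul_sum, integral_const_mul,
            RingHom.id_apply, smul_eq_mul]
          ring }
    refine sub_eq_zero.mp (MvPolynomial.linearMap_eq_zero_of_linearForm_pow T (2 * k)
      (fun x => sub_eq_zero.mpr ?_) hp)
    have hx := hmom k (WithLp.toLp 2 x)
    simp only [hform (WithLp.toLp 2 x), hx]
    rcases Nat.eq_zero_or_pos k with rfl | hk0
    · have : (L : ℝ) ≠ 0 := by positivity
      simp [designConst, this]
    · exact h k hk0 hk _
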